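/- The set of wedge angles whose two-collision velocity map has finite order, i.e. {θ ∈ (0, π) : there exists an integer n ≥ 1 with S_θⁿ = 1}, is dense in the interval (0, π). Equivalently, the set of wedge angles giving periodic no-slip wedge billiards is dense in (0, π). -/

import Mathlib

open Real Matrix

/-- The no-slip collision matrix for a wall with inward unit normal `e₂`. -/
noncomputable def noslipT : Matrix (Fin 3) (Fin 3) ℝ :=
  !![-1/3, 2 * Real.sqrt 2 / 3, 0;
     2 * Real.sqrt 2 / 3, 1/3, 0;
     0, 0, -1]

/-- Rotation of the spatial `(x₁, x₂)`-plane by angle `φ`, fixing `x₀`. -/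
noncomputable def rotMat (φ : ℝ) : Matrix (Fin 3) (Fin 3) ℝ :=
  !![1, 0, 0;
     0, Real.cos φ, -Real.sin φ;
     0, Real.sin φ, Real.cos φ]

/-- Collision map at the first wall of the angle-`θ` wedge. -/
noncomputable def Aplus (θ : ℝ) : Matrix (Fin 3) (Fin 3) ℝ :=
  rotMat ((Real.pi - θ) / 2) * noslipT * rotMat (-((Real.pi - θ) / 2))

/-- Collision map at the second wall of the angle-`θ` wedge. -/
noncomputable def Aminus (θ : ℝ) : Matrix (Fin 3) (Fin 3) ℝ :=
  rotMat (-((Real.pi - θ) / 2)) * noslipT * rotMat ((Real.pi - θ) / 2)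

/-- Two-collision velocity map of the angle-`θ` no-slip wedge. -/
noncomputable def wedgeS (θ : ℝ) : Matrix (Fin 3) (Fin 3) ℝ :=
  Aminus θ * Aplus θ

/-- Powers of a rotation in Rodrigues form: the angle is multiplied by the exponent. -/
lemma rodrigues_pow {A : Type*} [Ring A] [Algebra ℝ A] {K : A} (hK : K ^ 3 = -K) (β : ℝ)
    (n : ℕ) :
    (1 + Real.sin β • K + (1 - Real.cos β) • K ^ 2) ^ n =
      1 + Real.sin (n * β) • K + (1 - Real.cos (n * β)) • K ^ 2 := by
  have h12 : K * K ^ 2 = -K := by rw [← pow_succ', hK]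
  have h21 : K ^ 2 * K = -K := by rw [← pow_succ, hK]
  have h22 : K ^ 2 * K ^ 2 = -K ^ 2 := by
    rw [pow_two K, ← mul_assoc, ← pow_two K, h21, neg_mul, ← pow_two]
  induction n with
  | zero => simp
  | succ n ih =>
    have h : ((n + 1 : ℕ) : ℝ) * β = n * β + β := by push_cast; ring
    rw [pow_succ, ih, h, Real.sin_add, Real.cos_add]
    simp only [mul_add, add_mul, smul_mul_smul_comm, one_mul, mul_one, h12, h21, h22, ← sq K]
    module

/-- The cross product matrix of the (unnormalized) rotation axis of the two-collision map,
where `ψ` is half the angle between the two wall normals. -/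
noncomputable def wedgeAxisMat (ψ : ℝ) : Matrix (Fin 3) (Fin 3) ℝ :=
  !![0, 0, 2 * Real.sqrt 2 * Real.sin ψ / 3;
     0, 0, 4 * Real.sin ψ * Real.cos ψ / 3;
     -(2 * Real.sqrt 2 * Real.sin ψ / 3), -(4 * Real.sin ψ * Real.cos ψ / 3), 0]

lemma wedgeAxisMat_pow_three (ψ : ℝ) :
    wedgeAxisMat ψ ^ 3 = -(1 - ((4 * Real.cos ψ ^ 2 - 1) / 3) ^ 2) • wedgeAxisMat ψ := by
  have h2 : Real.sqrt 2 ^ 2 = 2 := Real.sq_sqrt (by norm_num)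
  have hs := Real.sin_sq_add_cos_sq ψ
  ext i j
  fin_cases i <;> fin_cases j <;>
    simp [wedgeAxisMat, pow_succ, Matrix.mul_apply, Fin.sum_univ_three] <;> grind

lemma wedgeS_eq_wedgeAxisMat (θ : ℝ) :
    wedgeS θ = 1 + (2 * ((4 * Real.cos ((Real.pi - θ) / 2) ^ 2 - 1) / 3)) •
        wedgeAxisMat ((Real.pi - θ) / 2) + (2 : ℝ) • wedgeAxisMat ((Real.pi - θ) / 2) ^ 2 := by
  unfold wedgeS Aminus Aplus
  generalize (Real.pi - θ) / 2 = ψ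
  have h2 : Real.sqrt 2 ^ 2 = 2 := Real.sq_sqrt (by norm_num)
  have hs := Real.sin_sq_add_cos_sq ψ
  ext i j
  fin_cases i <;> fin_cases j <;>
    simp [wedgeAxisMat, rotMat, noslipT, pow_succ, Matrix.mul_apply, Fin.sum_univ_three] <;> grind

/-- If `cos α = (1 - 2 cos θ) / 3`, then the two-collision map is a rotation by `2 α`. -/
lemma wedgeS_pow_eq_one {θ α : ℝ} (hα : Real.sin α ≠ 0)
    (h : Real.cos θ = (1 - 3 * Real.cos α) / 2) {n : ℕ} {k : ℤ} (hn : n * α = k * Real.pi) :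
    wedgeS θ ^ n = 1 := by
  have hc : (4 * Real.cos ((Real.pi - θ) / 2) ^ 2 - 1) / 3 = Real.cos α := by
    rw [Real.cos_sq, mul_div_cancel₀ _ two_ne_zero, Real.cos_pi_sub, h]
    ring
  have hL := wedgeAxisMat_pow_three ((Real.pi - θ) / 2)
  have hS := wedgeS_eq_wedgeAxisMat θ
  rw [hc] at hL hS
  rw [← Real.sin_sq] at hL
  generalize wedgeAxisMat ((Real.pi - θ) / 2) = L at hL hS
  have hK : ((Real.sin α)⁻¹ • L) ^ 3 = -((Real.sin α)⁻¹ • L) := by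
    rw [smul_pow, hL, smul_smul, ← neg_smul]
    congr 1
    field_simp
  have hrot : wedgeS θ = 1 + Real.sin (2 * α) • ((Real.sin α)⁻¹ • L) +
      (1 - Real.cos (2 * α)) • ((Real.sin α)⁻¹ • L) ^ 2 := by
    rw [hS, smul_pow, smul_smul, smul_smul, Real.sin_two_mul, Real.cos_two_mul, Real.cos_sq']
    congr 3 <;> field_simp
    ring
  have hn' : (n : ℝ) * (2 * α) = k * (2 * Real.pi) := by linear_combination 2 * hn
  have hsin : Real.sin (k * (2 * Real.pi)) = 0 := by
    simpa using Real.sin_add_int_mul_two_pi 0 k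
  rw [hrot, rodrigues_pow hK, hn', hsin, Real.cos_int_mul_two_pi]
  simp

/-- The set of wedge angles in `(0, π)` whose two-collision velocity map has
finite order (equivalently, giving periodic no-slip wedge billiards) is dense
in `(0, π)`. -/
theorem wedge_periodic_angles_dense :
    Set.Ioo 0 Real.pi ⊆
      closure {θ ∈ Set.Ioo 0 Real.pi | ∃ n : ℕ, 1 ≤ n ∧ wedgeS θ ^ n = 1} := by
  intro θ₀ hθ₀
  rw [_root_.mem_closure_iff]
  intro O hO hθO
  have hcos_lt : Real.cos θ₀ < 1 := by
    simpa using Real.cos_lt_cos_of_nonneg_of_le_pi le_rfl hθ₀.2.le hθ₀.1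
  have hlt_cos : -1 < Real.cos θ₀ := by
    simpa using Real.cos_lt_cos_of_nonneg_of_le_pi hθ₀.1.le le_rfl hθ₀.2
  let g : ℝ → ℝ := fun q ↦ (1 - 3 * Real.cos (q * Real.pi)) / 2
  have hg : Continuous g := by fun_prop
  let U : Set ℝ := Set.Ioo 0 1 ∩ g ⁻¹' Set.Ioo (-1) 1 ∩ (fun q ↦ Real.arccos (g q)) ⁻¹' O
  have hU : IsOpen U := (isOpen_Ioo.inter (isOpen_Ioo.preimage hg)).inter
    (hO.preimage (Real.continuous_arccos.comp hg))
  have hUne : U.Nonempty := by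
    have hα : g (Real.arccos ((1 - 2 * Real.cos θ₀) / 3) / Real.pi) = Real.cos θ₀ := by
      simp only [g]
      rw [div_mul_cancel₀ _ Real.pi_ne_zero, Real.cos_arccos (by linarith) (by linarith)]
      ring
    refine ⟨Real.arccos ((1 - 2 * Real.cos θ₀) / 3) / Real.pi, ⟨⟨?_, ?_⟩, ?_⟩, ?_⟩
    · exact div_pos (Real.arccos_pos.2 (by linarith)) Real.pi_pos
    · rw [div_lt_one Real.pi_pos]
      refine lt_of_le_of_ne (Real.arccos_le_pi _) fun h ↦ ?_
      linarith [Real.arccos_eq_pi.1 h]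
    · rw [Set.mem_preimage, hα]
      exact ⟨hlt_cos, hcos_lt⟩
    · rw [Set.mem_preimage, hα, Real.arccos_cos hθ₀.1.le hθ₀.2.le]
      exact hθO
  obtain ⟨q, ⟨⟨hq0, hq1⟩, hgq⟩, hqO⟩ := Rat.denseRange_cast.exists_mem_open hU hUne
  refine ⟨Real.arccos (g q), hqO, ⟨Real.arccos_pos.2 hgq.2, ?_⟩, q.den, q.den_pos, ?_⟩
  · refine lt_of_le_of_ne (Real.arccos_le_pi _) fun h ↦ ?_
    linarith [Real.arccos_eq_pi.1 h, hgq.1]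
  · refine wedgeS_pow_eq_one (α := q * Real.pi) (k := q.num) ?_
      (Real.cos_arccos hgq.1.le hgq.2.le) ?_
    · exact (Real.sin_pos_of_pos_of_lt_pi (mul_pos hq0 Real.pi_pos)
        (by nlinarith [Real.pi_pos])).ne'
    · have h : (q : ℝ) * q.den = q.num := by exact_mod_cast q.mul_den_eq_num
      rw [← h]
      ring
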